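/- (1) If m is even, then n_{1,1} = n_{1,−1} = ((p−1)/4)·(p^{m−1} + (−1)^{((p−1)/2)·(m/2)} p^{(m−2)/2}). (2) If m is odd, then n_{1,1} = ((p−1)/4)·(p^{m−1} + (−1)^{((p−1)/2)·((m−1)/2)} p^{(m−1)/2}) and n_{1,−1} = ((p−1)/4)·(p^{m−1} − (−1)^{((p−1)/2)·((m−1)/2)} p^{(m−1)/2}). -/

import Mathlib

/-- `n_{i,j} = #{a ∈ F_r^* : η(a) = i and η̄(Tr(a⁻¹)) = j}` where `η`, `η̄` are the
quadratic characters of `F_r` and `F_p` (note `η̄(0) = 0`, so membership forces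
`Tr(a⁻¹) ≠ 0`). -/
noncomputable def nij (p : ℕ) [Fact p.Prime] (F : Type) [Field F] [Fintype F]
    [DecidableEq F] [Algebra (ZMod p) F] (i j : ℤ) : ℕ :=
  Set.ncard {a : F | a ≠ 0 ∧ quadraticChar F a = i ∧
    quadraticChar (ZMod p) (Algebra.trace (ZMod p) F a⁻¹) = j}

open Finset in
lemma aux_sq_sum (K : Type) [Field K] [Fintype K] [DecidableEq K] (hK : ringChar K ≠ 2)
    (f : K → ℂ) : ∑ x : K, f (x ^ 2) = ∑ y : K, (1 + (quadraticChar K y : ℂ)) * f y := by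
  classical
  rw [← Finset.sum_fiberwise (s := Finset.univ) (g := fun x : K => x ^ 2)]
  refine Finset.sum_congr rfl fun y _ => ?_
  have h := quadraticChar_card_sqrts hK y
  have h2 : (#(Finset.univ.filter (fun x : K => x ^ 2 = y)) : ℤ) = quadraticChar K y + 1 := by
    rw [← h]; congr 2; ext; simp
  have h3 : ∑ x ∈ Finset.univ.filter (fun x : K => x ^ 2 = y), f (x ^ 2)
      = ∑ x ∈ Finset.univ.filter (fun x : K => x ^ 2 = y), f y :=
    Finset.sum_congr rfl fun x hx => by rw [(Finset.mem_filter.mp hx).2]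
  rw [h3, Finset.sum_const, nsmul_eq_mul]
  congr 1
  have h4 := congrArg (Int.cast : ℤ → ℂ) h2
  push_cast at h4
  rw [h4]; ring

lemma aux_diag (p : ℕ) [Fact p.Prime] (hp2 : p ≠ 2)
    (F : Type) [Field F] [Fintype F] [Algebra (ZMod p) F] (n : ℕ)
    (hn : Module.finrank (ZMod p) F = n) :
    ∃ (v : Module.Basis (Fin n) (ZMod p) F) (w : Fin n → ZMod p),
      (∀ c, Algebra.trace (ZMod p) F ((v.equivFun.symm c) ^ 2) = ∑ i, w i * c i ^ 2) ∧
      (∀ i, w i ≠ 0) ∧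
      quadraticChar (ZMod p) (∏ i, w i) = (-1) ^ (n - 1) := by
  classical
  have hrc : ringChar (ZMod p) ≠ 2 := by rwa [ZMod.ringChar_zmod_n]
  have h2 : (2 : ZMod p) ≠ 0 := Ring.two_ne_zero hrc
  have : Invertible (2 : ZMod p) := invertibleOfNonzero h2
  have : CharP F p := charP_of_injective_algebraMap (algebraMap (ZMod p) F).injective p
  obtain ⟨v0, hv⟩ := LinearMap.BilinForm.exists_orthogonal_basis
    (B := Algebra.traceForm (ZMod p) F)
    ⟨fun x y => by simp [Algebra.traceForm_apply, mul_comm]⟩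
  obtain ⟨v, hv⟩ : ∃ v : Module.Basis (Fin n) (ZMod p) F,
      (Algebra.traceForm (ZMod p) F).IsOrthoᵢ v := by
    subst hn
    exact ⟨v0, hv⟩
  have hort : ∀ i j, i ≠ j → Algebra.trace (ZMod p) F (v i * v j) = 0 := fun i j hij => hv hij
  set w : Fin n → ZMod p :=
    fun i => Algebra.trace (ZMod p) F (v i * v i) with hw
  have hdet : Algebra.discr (ZMod p) v = ∏ i, w i := by
    rw [Algebra.discr_def, ← Matrix.det_diagonal]
    congr 1
    ext i j
    rw [Algebra.traceMatrix_apply, Algebra.traceForm_apply, Matrix.diagonal_apply]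
    split_ifs with h
    · subst h; rfl
    · exact hort i j h
  have hne : ∏ i, w i ≠ 0 := hdet ▸ Algebra.discr_not_zero_of_basis (ZMod p) v
  refine ⟨v, w, ?_, fun i => (Finset.prod_ne_zero_iff.mp hne) i (Finset.mem_univ i), ?_⟩
  · intro c
    rw [Module.Basis.equivFun_symm_apply, sq, Finset.sum_mul_sum, map_sum]
    refine Finset.sum_congr rfl fun i _ => ?_
    rw [map_sum, Finset.sum_eq_single i]
    · rw [smul_mul_smul_comm, map_smul, smul_eq_mul]; ring
    · intro j _ hj
      rw [smul_mul_smul_comm, map_smul, hort i j hj.symm, smul_zero]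
    · simp
  · have hcard : Fintype.card F = p ^ n := by
      rw [Module.card_eq_pow_finrank (K := ZMod p), ZMod.card, hn]
    let M : Matrix (Fin n) (Fin n) F := fun i j => v i ^ (p ^ (j : ℕ))
    have htr : ∀ x : F, algebraMap (ZMod p) F (Algebra.trace (ZMod p) F x)
        = ∑ j : Fin n, x ^ (p ^ (j : ℕ)) := by
      intro x
      rw [FiniteField.algebraMap_trace_eq_sum_pow, Finset.sum_range, hn]
      simp
    have hMM : M * M.transpose = (Algebra.traceMatrix (ZMod p) v).map (algebraMap (ZMod p) F) := by
      ext i j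
      rw [Matrix.mul_apply, Matrix.map_apply, Algebra.traceMatrix_apply, Algebra.traceForm_apply,
        htr]
      refine Finset.sum_congr rfl fun k _ => ?_
      rw [Matrix.transpose_apply, mul_pow]
    have hδ : M.det ^ 2 = algebraMap (ZMod p) F (∏ i, w i) := by
      rw [← hdet, Algebra.discr_def, RingHom.map_det, RingHom.mapMatrix_apply, ← hMM,
        Matrix.det_mul, Matrix.det_transpose, sq]
    have hδ0 : M.det ≠ 0 := by
      intro h
      rw [h] at hδ
      apply hne
      apply (algebraMap (ZMod p) F).injective
      rw [← hδ]; simp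
    have hrot : M.map (frobenius F p) = M.submatrix id (finRotate n) := by
      ext i j
      rw [Matrix.map_apply, Matrix.submatrix_apply, frobenius_def]
      simp only [M, id]
      rw [← pow_mul, ← pow_succ]
      obtain _ | k := n
      · exact j.elim0
      by_cases hj : j = Fin.last k
      · subst hj
        rw [finRotate_last]
        have := FiniteField.pow_card (v i)
        rw [hcard] at this
        simpa using this
      · rw [coe_finRotate_of_ne_last hj]
    have hfrob : M.det ^ p = (-1) ^ (n - 1) * M.det := by
      rw [← frobenius_def, RingHom.map_det, RingHom.mapMatrix_apply, hrot, Matrix.det_permute',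
        sign_finRotate]
      simp
    have hp1 : M.det ^ (p - 1) = (-1) ^ (n - 1) := by
      apply mul_right_cancel₀ hδ0
      rw [← hfrob, ← pow_succ, Nat.sub_add_cancel (Fact.out : p.Prime).one_le]
    have hodd : p % 2 = 1 := (Fact.out : p.Prime).eq_two_or_odd.resolve_left hp2
    have hq : ((quadraticChar (ZMod p) (∏ i, w i) : ℤ) : F) = (((-1) ^ (n - 1) : ℤ) : F) := by
      have := quadraticChar_eq_pow_of_char_ne_two' hrc (∏ i, w i)
      rw [ZMod.card] at this
      have h5 := congrArg (algebraMap (ZMod p) F) this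
      rw [map_intCast, map_pow, ← hδ, ← pow_mul, show 2 * (p / 2) = p - 1 by omega, hp1] at h5
      rw [h5]; push_cast; rfl
    have hF2 : ringChar F ≠ 2 := by rwa [ringChar.eq F p]
    have h1 : (1 : F) ≠ -1 := fun h => Ring.neg_one_ne_one_of_char_ne_two hF2 h.symm
    rcases quadraticChar_dichotomy hne with h | h <;>
    rcases neg_one_pow_eq_or ℤ (n - 1) with h' | h' <;>
    rw [h, h'] at hq ⊢ <;> push_cast at hq
    · exact absurd hq h1
    · exact absurd hq h1.symm

/-- The quadratic character of the prime field with complex values. -/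
noncomputable def chiC (p : ℕ) [Fact p.Prime] : MulChar (ZMod p) ℂ :=
  (quadraticChar (ZMod p)).ringHomComp (Int.castRingHom ℂ)

lemma chiC_apply (p : ℕ) [Fact p.Prime] (t : ZMod p) :
    chiC p t = ((quadraticChar (ZMod p) t : ℤ) : ℂ) := rfl

lemma chiC_zero (p : ℕ) [Fact p.Prime] : chiC p 0 = 0 := by
  rw [chiC_apply]; simp

lemma chiC_sq (p : ℕ) [Fact p.Prime] {t : ZMod p} (ht : t ≠ 0) : chiC p t ^ 2 = 1 := by
  rw [chiC_apply]
  exact_mod_cast quadraticChar_sq_one ht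

lemma chiC_ne_one (p : ℕ) [Fact p.Prime] (hp2 : p ≠ 2) : chiC p ≠ 1 := by
  have hrc : ringChar (ZMod p) ≠ 2 := by rwa [ZMod.ringChar_zmod_n]
  exact (MulChar.ringHomComp_ne_one_iff (RingHom.injective_int _)).mpr (quadraticChar_ne_one hrc)

lemma chiC_quad (p : ℕ) [Fact p.Prime] : (chiC p).IsQuadratic :=
  (quadraticChar_isQuadratic _).comp _

/-- The quadratic Gauss sum of the prime field. -/
noncomputable def GC (p : ℕ) [Fact p.Prime] : ℂ := gaussSum (chiC p) ZMod.stdAddChar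

lemma GC_sq (p : ℕ) [Fact p.Prime] (hp2 : p ≠ 2) :
    GC p ^ 2 = (-1) ^ ((p - 1) / 2) * (p : ℂ) := by
  have hrc : ringChar (ZMod p) ≠ 2 := by rwa [ZMod.ringChar_zmod_n]
  have hodd : p % 2 = 1 := (Fact.out : p.Prime).eq_two_or_odd.resolve_left hp2
  rw [GC, gaussSum_sq (chiC_ne_one p hp2) (chiC_quad p) (ZMod.isPrimitive_stdAddChar p),
    chiC_apply, quadraticChar_neg_one hrc, ZMod.card, ZMod.χ₄_eq_neg_one_pow hodd,
    show (p - 1) / 2 = p / 2 by omega]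
  push_cast; rfl

lemma GC_ne_zero (p : ℕ) [Fact p.Prime] (hp2 : p ≠ 2) : GC p ≠ 0 := by
  intro h
  have h1 := GC_sq p hp2
  have hp0 : (p : ℂ) ≠ 0 := by exact_mod_cast (Fact.out : p.Prime).ne_zero
  rw [h, zero_pow two_ne_zero] at h1
  exact (mul_ne_zero (pow_ne_zero _ (by norm_num)) hp0) h1.symm

lemma GC_shift (p : ℕ) [Fact p.Prime] (hp2 : p ≠ 2) (u : ZMod p) :
    ∑ t : ZMod p, chiC p t * ZMod.stdAddChar (t * u) = chiC p u * GC p := by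
  by_cases hu : u = 0
  · subst hu
    simp only [mul_zero, AddChar.map_zero_eq_one, mul_one, MulChar.map_zero, zero_mul]
    exact MulChar.sum_eq_zero_of_ne_one (chiC_ne_one p hp2)
  · have h := gaussSum_mulShift (chiC p) ZMod.stdAddChar (Units.mk0 u hu)
    have h2 := chiC_sq p hu
    rw [GC, ← h, ← mul_assoc, Units.val_mk0, ← sq, h2, one_mul, gaussSum]
    refine Finset.sum_congr rfl fun t _ => ?_
    rw [AddChar.mulShift_apply, mul_comm u]

lemma aux_one (p : ℕ) [Fact p.Prime] (hp2 : p ≠ 2) {w : ZMod p} (hw : w ≠ 0) :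
    ∑ c : ZMod p, ZMod.stdAddChar (w * c ^ 2) = chiC p w * GC p := by
  have hrc : ringChar (ZMod p) ≠ 2 := by rwa [ZMod.ringChar_zmod_n]
  rw [aux_sq_sum (ZMod p) hrc (fun y => ZMod.stdAddChar (w * y)), ← GC_shift p hp2 w]
  simp_rw [add_mul, one_mul, mul_comm w]
  rw [Finset.sum_add_distrib, AddChar.sum_mulShift w (ZMod.isPrimitive_stdAddChar p), if_neg hw]
  simp [chiC_apply]

lemma aux_map_sum (p : ℕ) [Fact p.Prime] {ι : Type} (s : Finset ι) (f : ι → ZMod p) :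
    (ZMod.stdAddChar (∑ i ∈ s, f i) : ℂ) = ∏ i ∈ s, ZMod.stdAddChar (f i) := by
  classical
  induction s using Finset.induction_on with
  | empty => simp
  | insert a s ha ih => rw [Finset.sum_insert ha, Finset.prod_insert ha, AddChar.map_add_eq_mul, ih]

lemma aux_S (p : ℕ) [Fact p.Prime] (hp2 : p ≠ 2)
    (F : Type) [Field F] [Fintype F] [Algebra (ZMod p) F] (n : ℕ)
    (hn : Module.finrank (ZMod p) F = n) {t : ZMod p} (ht : t ≠ 0) :
    ∑ x : F, ZMod.stdAddChar (t * Algebra.trace (ZMod p) F (x ^ 2))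
      = chiC p t ^ n * ((-1) ^ (n - 1) * GC p ^ n) := by
  obtain ⟨v, w, h1, h2, h3⟩ := aux_diag p hp2 F n hn
  rw [← v.equivFun.symm.toEquiv.sum_comp]
  have : ∀ c : Fin n → ZMod p, (ZMod.stdAddChar (t * Algebra.trace (ZMod p) F
      ((v.equivFun.symm.toEquiv c) ^ 2)) : ℂ) = ∏ i, ZMod.stdAddChar ((t * w i) * c i ^ 2) := by
    intro c
    have := h1 c
    rw [LinearEquiv.coe_toEquiv, this, Finset.mul_sum, aux_map_sum]
    simp_rw [mul_assoc]
  simp_rw [this]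
  rw [← Fintype.prod_sum (fun i (c : ZMod p) => (ZMod.stdAddChar ((t * w i) * c ^ 2) : ℂ))]
  simp_rw [fun i => aux_one p hp2 (mul_ne_zero ht (h2 i)), map_mul]
  rw [Finset.prod_mul_distrib, Finset.prod_mul_distrib, ← map_prod (chiC p) w, chiC_apply p (∏ i, w i), h3]
  simp
  ring

lemma sum_chiC_pow (p : ℕ) [Fact p.Prime] (k : ℕ) (hk : Even k) (hk0 : k ≠ 0) :
    ∑ t : ZMod p, chiC p t ^ k = p - 1 := by
  obtain ⟨j, rfl⟩ := hk
  have : ∀ t : ZMod p, chiC p t ^ (j + j) = 1 - if t = 0 then 1 else 0 := by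
    intro t
    split_ifs with h
    · subst h; simp only [chiC_zero, zero_pow hk0, sub_self]
    · rw [← two_mul, pow_mul, chiC_sq p h]; simp
  simp_rw [this]
  simp [Finset.sum_sub_distrib, ZMod.card]

lemma sum_chiC_pow_odd (p : ℕ) [Fact p.Prime] (hp2 : p ≠ 2) (k : ℕ) (hk : Odd k) :
    ∑ t : ZMod p, chiC p t ^ k = 0 := by
  obtain ⟨j, rfl⟩ := hk
  rw [← MulChar.sum_eq_zero_of_ne_one (chiC_ne_one p hp2)]
  refine Finset.sum_congr rfl fun t _ => ?_
  by_cases h : t = 0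
  · subst h; simp [chiC_zero]
  · rw [pow_succ, pow_mul, chiC_sq p h, one_pow, one_mul]

lemma aux_E (p : ℕ) [Fact p.Prime] (hp2 : p ≠ 2)
    (F : Type) [Field F] [Fintype F] [Algebra (ZMod p) F] (n : ℕ)
    (hn : Module.finrank (ZMod p) F = n) :
    (∑ x : F, chiC p (Algebra.trace (ZMod p) F (x ^ 2))) * GC p
      = ((-1) ^ (n - 1) * GC p ^ n) * ∑ t : ZMod p, chiC p t ^ (n + 1) := by
  rw [Finset.sum_mul]
  simp_rw [← GC_shift p hp2]
  rw [Finset.sum_comm, Finset.mul_sum]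
  refine Finset.sum_congr rfl fun t _ => ?_
  rw [← Finset.mul_sum]
  by_cases h : t = 0
  · subst h; simp [chiC_zero]
  · rw [aux_S p hp2 F n hn h]; ring

lemma aux_A (p : ℕ) [Fact p.Prime] (hp2 : p ≠ 2)
    (F : Type) [Field F] [Fintype F] [Algebra (ZMod p) F] (n : ℕ)
    (hn : Module.finrank (ZMod p) F = n) :
    (∑ x : F, chiC p (Algebra.trace (ZMod p) F (x ^ 2)) ^ 2) * p
      = (p - 1) * p ^ n
        - ((-1) ^ (n - 1) * GC p ^ n) * ∑ t : ZMod p, chiC p t ^ (n + 2) := by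
  have hcard : Fintype.card F = p ^ n := by
    rw [Module.card_eq_pow_finrank (K := ZMod p), ZMod.card, hn]
  have key : ∀ u : ZMod p, chiC p u ^ 2 * p
      = (p - 1) - ∑ t : ZMod p, chiC p t ^ 2 * ZMod.stdAddChar (t * u) := by
    intro u
    have h1 : ∀ t : ZMod p, chiC p t ^ 2 * ZMod.stdAddChar (t * u)
        = ZMod.stdAddChar (t * u) - if t = 0 then 1 else 0 := by
      intro t
      split_ifs with h
      · subst h; simp [chiC_zero]
      · rw [chiC_sq p h]; simp
    simp_rw [h1]
    rw [Finset.sum_sub_distrib, AddChar.sum_mulShift u (ZMod.isPrimitive_stdAddChar p)]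
    split_ifs with h
    · subst h; simp [ZMod.card, chiC_zero]
    · rw [chiC_sq p h]; simp
  rw [Finset.sum_mul]
  simp_rw [key]
  rw [Finset.sum_sub_distrib, Finset.sum_comm, Finset.mul_sum]
  congr 1
  · simp [hcard]; ring
  refine Finset.sum_congr rfl fun t _ => ?_
  rw [← Finset.mul_sum]
  by_cases h : t = 0
  · subst h; simp [chiC_zero]
  · rw [aux_S p hp2 F n hn h]; ring

lemma aux_nij (p : ℕ) [Fact p.Prime] (hp2 : p ≠ 2)
    (F : Type) [Field F] [Fintype F] [DecidableEq F] [Algebra (ZMod p) F] (j : ℤ)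
    (hj : j = 1 ∨ j = -1) :
    4 * (nij p F 1 j : ℂ) = ∑ x : F, chiC p (Algebra.trace (ZMod p) F (x ^ 2)) ^ 2
      + j * ∑ x : F, chiC p (Algebra.trace (ZMod p) F (x ^ 2)) := by
  classical
  have : CharP F p := charP_of_injective_algebraMap (algebraMap (ZMod p) F).injective p
  have hF2 : ringChar F ≠ 2 := by rwa [ringChar.eq F p]
  rw [Finset.mul_sum, ← Finset.sum_add_distrib, aux_sq_sum F hF2
    (fun y => chiC p (Algebra.trace (ZMod p) F y) ^ 2 + j * chiC p (Algebra.trace (ZMod p) F y)),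
    ← Equiv.sum_comp (Equiv.inv F)]
  have h1 : (nij p F 1 j : ℂ) = ∑ a : F, if (a ≠ 0 ∧ quadraticChar F a = 1 ∧
      quadraticChar (ZMod p) (Algebra.trace (ZMod p) F a⁻¹) = j) then (1 : ℂ) else 0 := by
    rw [nij, Set.ncard_eq_toFinset_card', Finset.sum_boole]
    congr 2
    ext a
    simp
  rw [h1, Finset.mul_sum]
  refine Finset.sum_congr rfl fun a _ => ?_
  simp only [Equiv.inv_apply, chiC_apply]
  by_cases ha : a = 0
  · subst ha; simp
  have hinv : quadraticChar F a⁻¹ = quadraticChar F a := by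
    have h2 : quadraticChar F a⁻¹ * quadraticChar F a = 1 := by
      rw [← map_mul, inv_mul_cancel₀ ha, map_one]
    rcases quadraticChar_dichotomy ha with h | h <;> rw [h] at h2 ⊢ <;> omega
  rw [hinv]
  generalize Algebra.trace (ZMod p) F a⁻¹ = u
  rcases quadraticChar_isQuadratic (F := ZMod p) u with hu | hu | hu <;>
  rcases quadraticChar_dichotomy ha with h | h <;> rcases hj with rfl | rfl <;>
  rw [h, hu] <;> norm_num [ha]

/-- STATEMENT 13 (Lemma on `n_{1,1}` and `n_{1,-1}`), stated with both sides
multiplied by 4: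
if `m` is even then `n_{1,1} = n_{1,-1} = ((p-1)/4)(p^{m-1} + (-1)^{((p-1)/2)(m/2)} p^{(m-2)/2})`;
if `m` is odd then `n_{1,±1} = ((p-1)/4)(p^{m-1} ± (-1)^{((p-1)/2)((m-1)/2)} p^{(m-1)/2})`. -/
theorem stmt_13 (p m : ℕ) [Fact p.Prime] (hp2 : p ≠ 2) (hm : 2 ≤ m)
    (F : Type) [Field F] [Fintype F] [DecidableEq F] [Algebra (ZMod p) F]
    (hcard : Fintype.card F = p ^ m) :
    (Even m →
      4 * (nij p F 1 1 : ℤ)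
        = (p - 1) * (p ^ (m - 1) + (-1) ^ ((p - 1) / 2 * (m / 2)) * p ^ ((m - 2) / 2)) ∧
      4 * (nij p F 1 (-1) : ℤ)
        = (p - 1) * (p ^ (m - 1) + (-1) ^ ((p - 1) / 2 * (m / 2)) * p ^ ((m - 2) / 2))) ∧
    (Odd m →
      4 * (nij p F 1 1 : ℤ)
        = (p - 1) * (p ^ (m - 1)
            + (-1) ^ ((p - 1) / 2 * ((m - 1) / 2)) * p ^ ((m - 1) / 2)) ∧
      4 * (nij p F 1 (-1) : ℤ)
        = (p - 1) * (p ^ (m - 1)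
            - (-1) ^ ((p - 1) / 2 * ((m - 1) / 2)) * p ^ ((m - 1) / 2))) := by
  have hp0 : (p : ℂ) ≠ 0 := by exact_mod_cast (Fact.out : p.Prime).ne_zero
  have hG := GC_ne_zero p hp2
  have hG2 := GC_sq p hp2
  have hn : Module.finrank (ZMod p) F = m := by
    have h := Module.card_eq_pow_finrank (K := ZMod p) (V := F)
    rw [ZMod.card, hcard] at h
    exact (Nat.pow_right_injective (Fact.out : p.Prime).two_le h).symm
  have hE := aux_E p hp2 F m hn
  have hA := aux_A p hp2 F m hn
  have h1 := aux_nij p hp2 F 1 (Or.inl rfl)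
  have h2 := aux_nij p hp2 F (-1) (Or.inr rfl)
  set E := ∑ x : F, chiC p (Algebra.trace (ZMod p) F (x ^ 2))
  set A := ∑ x : F, chiC p (Algebra.trace (ZMod p) F (x ^ 2)) ^ 2
  push_cast at h1 h2
  constructor
  · rintro ⟨k, rfl⟩
    obtain ⟨l, rfl⟩ : ∃ l, k = l + 1 := ⟨k - 1, by omega⟩
    rw [sum_chiC_pow_odd p hp2 _ (by simp [parity_simps]), mul_zero] at hE
    have hE0 : E = 0 := (mul_eq_zero.mp hE).resolve_right hG
    rw [sum_chiC_pow p _ (by simp [parity_simps]) (by omega), ← two_mul (l + 1),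
      pow_mul (GC p), hG2, Odd.neg_one_pow ⟨l, by omega⟩] at hA
    have hA' : A = (p - 1) * (p ^ (l + 1 + (l + 1) - 1)
        + (-1) ^ ((p - 1) / 2 * ((l + 1 + (l + 1)) / 2)) * p ^ ((l + 1 + (l + 1) - 2) / 2)) := by
      apply mul_right_cancel₀ hp0
      rw [hA, show l + 1 + (l + 1) - 1 = 2 * l + 1 by omega,
        show (l + 1 + (l + 1)) / 2 = l + 1 by omega, show (l + 1 + (l + 1) - 2) / 2 = l by omega,
        pow_mul (-1 : ℂ)]
      ring
    rw [hE0, mul_zero, add_zero, hA'] at h1 h2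
    constructor
    · exact_mod_cast h1
    · exact_mod_cast h2
  · rintro ⟨k, rfl⟩
    rw [sum_chiC_pow_odd p hp2 (2 * k + 1 + 2) (by simp [parity_simps]), mul_zero, sub_zero] at hA
    rw [sum_chiC_pow p _ (by simp [parity_simps]) (by omega), Even.neg_one_pow ⟨k, by omega⟩,
      pow_succ, pow_mul, hG2] at hE
    have hE' : E = (p - 1) * ((-1) ^ ((p - 1) / 2 * ((2 * k + 1 - 1) / 2))
        * p ^ ((2 * k + 1 - 1) / 2)) := by
      apply mul_right_cancel₀ hG
      rw [hE, show (2 * k + 1 - 1) / 2 = k by omega, pow_mul (-1 : ℂ)]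
      ring
    have hA' : A = (p - 1) * p ^ (2 * k + 1 - 1) := by
      apply mul_right_cancel₀ hp0
      rw [hA, show 2 * k + 1 - 1 = 2 * k by omega]
      ring
    rw [hA', hE'] at h1 h2
    constructor
    · rw [one_mul, ← mul_add] at h1
      exact_mod_cast h1
    · rw [neg_one_mul, ← sub_eq_add_neg, ← mul_sub] at h2
      exact_mod_cast h2
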